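/- Let ν ∈ ℝ, α ∈ ℝ with cosh ν ≠ cos α. Then Σ_{k∈ℤ} 1/(2kπ + √−1 ν − α)² + Σ_{k∈ℤ} 1/(2kπ − √−1 ν − α)² = (1 − cosh ν · cos α)/(cos α − cosh ν)². -/

import Mathlib

open Complex in
lemma aux_pos (w : ℂ) (hw : 0 < w.im) :
    ∑' k : ℤ, (1 : ℂ) / (2 * (k : ℂ) * Real.pi + w) ^ 2 = 1 / (2 * (1 - Complex.cos w)) := by
  have hpi : (Real.pi : ℂ) ≠ 0 := by exact_mod_cast Real.pi_ne_zero
  have him : 0 < (w / (2 * Real.pi)).im := by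
    have : w / (2 * Real.pi) = w / ((2 * Real.pi : ℝ) : ℂ) := by push_cast; rfl
    rw [this, Complex.div_ofReal_im]
    have := Real.pi_pos
    positivity
  have key := EisensteinSeries.qExpansion_identity (k := 1) le_rfl ⟨w / (2 * Real.pi), him⟩
  have hq : 2 * (Real.pi : ℂ) * I * (w / (2 * Real.pi)) = w * I := by field_simp
  have hn : ‖cexp (w * I)‖ < 1 := by
    rw [Complex.norm_exp, Real.exp_lt_one_iff]; simpa using hw
  have hterm : ∀ k : ℤ, (1 : ℂ) / (2 * (k : ℂ) * Real.pi + w) ^ 2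
      = 1 / (4 * Real.pi ^ 2) * (1 / (w / (2 * Real.pi) + k) ^ (1 + 1)) := by
    intro k
    have : 2 * (k : ℂ) * Real.pi + w = 2 * Real.pi * (w / (2 * Real.pi) + k) := by
      field_simp; ring
    rw [this, mul_pow, one_div, mul_inv]
    ring
  simp_rw [hterm]
  rw [tsum_mul_left]
  simp only at key
  rw [key, hq]
  simp only [pow_one]
  rw [tsum_coe_mul_geometric_of_norm_lt_one hn]
  have he : cexp (w * I) ≠ 0 := Complex.exp_ne_zero _
  have h1 : 1 - cexp (w * I) ≠ 0 := by
    intro h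
    rw [← sub_eq_zero.mp h] at hn
    simp at hn
  have hc : 2 * (1 - Complex.cos w) = - (1 - cexp (w * I)) ^ 2 / cexp (w * I) := by
    rw [Complex.cos, neg_mul, Complex.exp_neg]
    field_simp
    ring
  rw [hc]
  field_simp
  simp [mul_pow]
  ring

lemma aux_neg (w : ℂ) :
    ∑' k : ℤ, (1 : ℂ) / (2 * (k : ℂ) * Real.pi + -w) ^ 2 =
    ∑' k : ℤ, (1 : ℂ) / (2 * (k : ℂ) * Real.pi + w) ^ 2 := by
  rw [← (Equiv.neg ℤ).tsum_eq]
  refine tsum_congr fun k => ?_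
  congr 1
  simp only [Equiv.neg_apply]
  push_cast
  ring

lemma aux_ne (w : ℂ) (hw : w.im ≠ 0) :
    ∑' k : ℤ, (1 : ℂ) / (2 * (k : ℂ) * Real.pi + w) ^ 2 = 1 / (2 * (1 - Complex.cos w)) := by
  rcases lt_or_gt_of_ne hw with h | h
  · rw [← aux_neg, aux_pos _ (by simpa using h), Complex.cos_neg]
  · exact aux_pos w h

lemma aux_real (a : ℝ) (ha : Real.cos a ≠ 1) :
    ∑' k : ℤ, (1 : ℂ) / (2 * (k : ℂ) * Real.pi + (a : ℂ)) ^ 2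
      = 1 / (2 * (1 - Complex.cos a)) := by
  have hne : ∀ k : ℤ, 2 * (k : ℝ) * Real.pi + a ≠ 0 := by
    intro k hk
    apply ha
    rw [Real.cos_eq_one_iff]
    exact ⟨-k, by push_cast; linarith⟩
  have hre : ∀ (k : ℤ) (t : ℝ),
      (2 * (k : ℂ) * Real.pi + ((a : ℂ) + t * Complex.I)).re = 2 * (k : ℝ) * Real.pi + a := by
    intro k t
    have : 2 * (k : ℂ) * Real.pi + ((a : ℂ) + t * Complex.I)
      = ((2 * (k : ℝ) * Real.pi + a : ℝ) : ℂ) + t * Complex.I := by push_cast; ring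
    rw [this]; simp
  have hsum : Summable fun k : ℤ => 1 / |2 * (k : ℝ) * Real.pi + a| ^ 2 := by
    have h := ((Real.summable_one_div_int_add_rpow (a / (2 * Real.pi)) 2).mpr
      one_lt_two).mul_left (1 / (2 * Real.pi) ^ 2)
    refine h.congr fun k => ?_
    have : 2 * (k : ℝ) * Real.pi + a = 2 * Real.pi * (k + a / (2 * Real.pi)) := by
      field_simp
    rw [this, Real.rpow_two, sq_abs, sq_abs, mul_pow (2 * Real.pi) (k + a / (2 * Real.pi)),
      one_div, one_div, one_div, mul_inv]
  have hcont : Continuous fun t : ℝ =>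
      ∑' k : ℤ, (1 : ℂ) / (2 * (k : ℂ) * Real.pi + ((a : ℂ) + t * Complex.I)) ^ 2 := by
    refine continuous_tsum (fun k => ?_) hsum (fun k t => ?_)
    · refine Continuous.div (by fun_prop) (by fun_prop) fun t => ?_
      refine pow_ne_zero _ fun h0 => hne k ?_
      rw [← hre k t, h0, Complex.zero_re]
    · rw [norm_div, norm_one, norm_pow]
      have h1 := Complex.abs_re_le_norm (2 * (k : ℂ) * Real.pi + ((a : ℂ) + t * Complex.I))
      rw [hre] at h1
      have := abs_pos.mpr (hne k)
      gcongr
  have h1 : Filter.Tendsto (fun t : ℝ =>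
      ∑' k : ℤ, (1 : ℂ) / (2 * (k : ℂ) * Real.pi + ((a : ℂ) + t * Complex.I)) ^ 2)
      (nhdsWithin 0 {0}ᶜ)
      (nhds (∑' k : ℤ, (1 : ℂ) / (2 * (k : ℂ) * Real.pi + (a : ℂ)) ^ 2)) := by
    have := (hcont.tendsto 0).mono_left (nhdsWithin_le_nhds (s := {0}ᶜ))
    simpa using this
  have hc : (2 : ℂ) * (1 - Complex.cos a) ≠ 0 := by
    refine mul_ne_zero two_ne_zero (sub_ne_zero.mpr fun h => ha ?_)
    exact_mod_cast h.symm
  have h2 : Filter.Tendsto (fun t : ℝ => 1 / (2 * (1 - Complex.cos ((a : ℂ) + t * Complex.I))))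
      (nhdsWithin 0 {0}ᶜ) (nhds (1 / (2 * (1 - Complex.cos a)))) := by
    have : ContinuousAt
        (fun t : ℝ => 1 / (2 * (1 - Complex.cos ((a : ℂ) + t * Complex.I)))) 0 := by
      refine ContinuousAt.div (by fun_prop) (by fun_prop) (by simpa using hc)
    have := this.tendsto.mono_left (nhdsWithin_le_nhds (s := {0}ᶜ))
    simpa using this
  refine tendsto_nhds_unique h1 (h2.congr' ?_)
  filter_upwards [self_mem_nhdsWithin] with t ht
  exact (aux_ne _ (by simpa using ht)).symm

lemma aux_all (w : ℂ) (hw : Complex.cos w ≠ 1) :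
    ∑' k : ℤ, (1 : ℂ) / (2 * (k : ℂ) * Real.pi + w) ^ 2 = 1 / (2 * (1 - Complex.cos w)) := by
  by_cases h : w.im = 0
  · obtain ⟨a, rfl⟩ : ∃ a : ℝ, w = a := ⟨w.re, by apply Complex.ext <;> simp [h]⟩
    exact aux_real a (by exact_mod_cast hw)
  · exact aux_ne w h

/-- For real `ν, α` with `cosh ν ≠ cos α`,
`∑_{k∈ℤ} 1/(2kπ + iν - α)² + ∑_{k∈ℤ} 1/(2kπ - iν - α)² = (1 - cosh ν cos α)/(cos α - cosh ν)²`. -/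
theorem stmt_6 (ν α : ℝ) (h : Real.cosh ν ≠ Real.cos α) :
    (∑' k : ℤ, (1 : ℂ) / (2 * (k : ℂ) * Real.pi + Complex.I * ν - α) ^ 2) +
      (∑' k : ℤ, (1 : ℂ) / (2 * (k : ℂ) * Real.pi - Complex.I * ν - α) ^ 2) =
      (((1 - Real.cosh ν * Real.cos α) / (Real.cos α - Real.cosh ν) ^ 2 : ℝ) : ℂ) := by
  have hC : (Complex.cosh ν - Complex.cos α) ≠ 0 := by
    rw [sub_ne_zero]; exact_mod_cast h
  have e1 : Complex.cos (Complex.I * ν - α) = Complex.cosh ν * Complex.cos α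
      + Complex.sinh ν * Complex.sin α * Complex.I := by
    rw [Complex.cos_sub, mul_comm Complex.I, Complex.cos_mul_I, Complex.sin_mul_I]; ring
  have e2 : Complex.cos (-(Complex.I * ν) - α) = Complex.cosh ν * Complex.cos α
      - Complex.sinh ν * Complex.sin α * Complex.I := by
    rw [Complex.cos_sub, Complex.cos_neg, Complex.sin_neg, mul_comm Complex.I,
      Complex.cos_mul_I, Complex.sin_mul_I]; ring
  have hprod : (1 - Complex.cos (Complex.I * ν - α)) * (1 - Complex.cos (-(Complex.I * ν) - α))
      = (Complex.cos α - Complex.cosh ν) ^ 2 := by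
    rw [e1, e2]
    have a1 := Complex.sin_sq_add_cos_sq (α : ℂ)
    have a2 := Complex.cosh_sq (ν : ℂ)
    have a3 := Complex.I_sq
    linear_combination (-Complex.sinh ν ^ 2 * Complex.sin α ^ 2) * a3
      + Complex.sinh ν ^ 2 * a1 + (Complex.cos (α : ℂ) ^ 2 - 1) * a2
  have hne : (Complex.cos α - Complex.cosh ν) ^ 2 ≠ 0 := by
    refine pow_ne_zero _ fun h0 => hC ?_
    linear_combination -h0
  have hm := hne
  rw [← hprod] at hm
  have n1 := left_ne_zero_of_mul hm
  have n2 := right_ne_zero_of_mul hm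
  have s1 := aux_all (Complex.I * ν - α) (fun hh => n1 (by rw [hh, sub_self]))
  have s2 := aux_all (-(Complex.I * ν) - α) (fun hh => n2 (by rw [hh, sub_self]))
  have t1 : ∀ k : ℤ, 2 * (k : ℂ) * Real.pi + Complex.I * ν - α
      = 2 * (k : ℂ) * Real.pi + (Complex.I * ν - α) := fun k => by ring
  have t2 : ∀ k : ℤ, 2 * (k : ℂ) * Real.pi - Complex.I * ν - α
      = 2 * (k : ℂ) * Real.pi + (-(Complex.I * ν) - α) := fun k => by ring
  simp_rw [t1, t2]
  rw [s1, s2]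
  push_cast
  rw [← hprod]
  have hs : (1 - Complex.cosh ν * Complex.cos α : ℂ)
      = ((1 - Complex.cos (Complex.I * ν - α)) + (1 - Complex.cos (-(Complex.I * ν) - α))) / 2 := by
    rw [e1, e2]; ring
  rw [hs]
  field_simp
  ring
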